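/- For all integers m, n ≥ 2 there exist positive margins u ∈ ℝ^m and v ∈ ℝ^n and two vertices O and F of the m×n transportation polytope P(u,v) such that whenever F − O = ∑_{i=1}^k αᵢ gⁱ with circuits gⁱ of the m×n transportation problem and reals αᵢ > 0, then k ≥ min{(m−1)(n−1), m+n−1}. Equivalently, every circuit walk (with feasibility of intermediate points not required) from O to F has length at least min{(m−1)(n−1), m+n−1}. -/

import Mathlib

/-- The m×n transportation polytope with margins u, v. -/
def TP (m n : ℕ) (u : Fin m → ℝ) (v : Fin n → ℝ) : Set (Matrix (Fin m) (Fin n) ℝ) :=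
  {y | (∀ i j, 0 ≤ y i j) ∧ (∀ i, ∑ j, y i j = u i) ∧ (∀ j, ∑ i, y i j = v j)}

/-- A circuit of the m×n transportation problem. -/
def IsCircuit (m n : ℕ) (g : Matrix (Fin m) (Fin n) ℝ) : Prop :=
  g ≠ 0 ∧ (∀ i, ∑ j, g i j = 0) ∧ (∀ j, ∑ i, g i j = 0) ∧
    ∀ h : Matrix (Fin m) (Fin n) ℝ, h ≠ 0 → (∀ i, ∑ j, h i j = 0) →
      (∀ j, ∑ i, h i j = 0) →
      {p : Fin m × Fin n | h p.1 p.2 ≠ 0} ⊆ {p : Fin m × Fin n | g p.1 p.2 ≠ 0} →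
      {p : Fin m × Fin n | h p.1 p.2 ≠ 0} = {p : Fin m × Fin n | g p.1 p.2 ≠ 0}

/-- Combinatorial certificate: two tree-supported points with common margins. -/
def Good (ρ κ ι : Type) [Fintype ρ] [Fintype κ] : Prop :=
  ∃ O F : ρ → κ → ℝ,
    (∀ i j, 0 ≤ O i j) ∧ (∀ i j, 0 ≤ F i j) ∧
    (∀ i, ∑ j, F i j = ∑ j, O i j) ∧ (∀ j, ∑ i, F i j = ∑ i, O i j) ∧
    (∀ i, 0 < ∑ j, O i j) ∧ (∀ j, 0 < ∑ i, O i j) ∧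
    (∀ z : ρ → κ → ℝ, (∀ i, ∑ j, z i j = 0) → (∀ j, ∑ i, z i j = 0) →
      (∀ i j, O i j = 0 → z i j = 0) → ∀ i j, z i j = 0) ∧
    (∀ z : ρ → κ → ℝ, (∀ i, ∑ j, z i j = 0) → (∀ j, ∑ i, z i j = 0) →
      (∀ i j, F i j = 0 → z i j = 0) → ∀ i j, z i j = 0) ∧
    ∃ x : ι → ℝ, LinearIndependent ℚ x ∧ ∀ t, ∃ i j, x t = O i j - F i j

lemma Good.symm {ρ κ ι : Type} [Fintype ρ] [Fintype κ] (h : Good ρ κ ι) : Good κ ρ ι := by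
  obtain ⟨O, F, h1, h2, h3, h4, h5, h6, h7, h8, x, hx, h9⟩ := h
  refine ⟨fun j i => O i j, fun j i => F i j, fun j i => h1 i j, fun j i => h2 i j, h4, h3, h6, h5,
    ?_, ?_, x, hx, fun t => ?_⟩
  · intro z a b c i j
    exact h7 (fun i j => z j i) b a (fun i j => c j i) j i
  · intro z a b c i j
    exact h8 (fun i j => z j i) b a (fun i j => c j i) j i
  · obtain ⟨i, j, h⟩ := h9 t
    exact ⟨j, i, h⟩

lemma Good.reindex {ρ κ ι ρ' : Type} [Fintype ρ] [Fintype κ] [Fintype ρ']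
    (e : ρ' ≃ ρ) (h : Good ρ κ ι) : Good ρ' κ ι := by
  obtain ⟨O, F, h1, h2, h3, h4, h5, h6, h7, h8, x, hx, h9⟩ := h
  have key : ∀ f : ρ → ℝ, ∑ i, f (e i) = ∑ i, f i := fun f => Equiv.sum_comp e f
  have key' : ∀ f : ρ' → ℝ, ∑ i, f (e.symm i) = ∑ i, f i := fun f => Equiv.sum_comp e.symm f
  refine ⟨fun i j => O (e i) j, fun i j => F (e i) j, fun i j => h1 _ j, fun i j => h2 _ j,
    fun i => h3 _, fun j => ?_, fun i => h5 _, fun j => ?_, ?_, ?_, x, hx, fun t => ?_⟩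
  · rw [key (fun i => F i j), key (fun i => O i j)]; exact h4 j
  · rw [key (fun i => O i j)]; exact h6 j
  · intro z a b c i j
    have := h7 (fun i j => z (e.symm i) j) (fun i => a _)
      (fun j => (key' (fun i => z i j)).trans (b j)) (fun i j hh => c _ _ (by simpa using hh)) (e i) j
    simpa using this
  · intro z a b c i j
    have := h8 (fun i j => z (e.symm i) j) (fun i => a _)
      (fun j => (key' (fun i => z i j)).trans (b j)) (fun i j hh => c _ _ (by simpa using hh)) (e i) j
    simpa using this
  · obtain ⟨i, j, h⟩ := h9 t
    exact ⟨e.symm i, j, by simpa using h⟩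

/-- entries of a circuit are rational multiples of a common real -/
lemma circuit_rational {m n : ℕ} {g : Matrix (Fin m) (Fin n) ℝ} (hg : IsCircuit m n g) :
    ∃ (c : ℝ) (q : Fin m → Fin n → ℚ), ∀ i j, g i j = (q i j : ℝ) * c := by
  obtain ⟨hne, hr, hc, hmin⟩ := hg
  obtain ⟨a, b, hab⟩ : ∃ a b, g a b ≠ 0 := by
    by_contra! hcon
    exact hne (by ext i j; exact hcon i j)
  obtain ⟨φ, hφ⟩ : ∃ φ : ℝ →ₗ[ℚ] ℚ, φ (g a b) ≠ 0 := by
    by_contra! hcon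
    exact hab ((Module.forall_dual_apply_eq_zero_iff ℚ (g a b)).1 hcon)
  have hsub : ∀ i j, (φ (g i j) : ℝ) ≠ 0 → g i j ≠ 0 := by
    intro i j h h0
    rw [h0] at h
    simp at h
  refine ⟨g a b / (φ (g a b) : ℝ), fun i j => φ (g i j), ?_⟩
  have hφ' : (φ (g a b) : ℝ) ≠ 0 := by exact_mod_cast hφ
  have hr' : ∀ i, ∑ j, (φ (g i j) : ℝ) = 0 := by
    intro i
    have : φ (∑ j, g i j) = 0 := by rw [hr i]; simp
    rw [map_sum] at this
    exact_mod_cast this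
  have hc' : ∀ j, ∑ i, (φ (g i j) : ℝ) = 0 := by
    intro j
    have : φ (∑ i, g i j) = 0 := by rw [hc j]; simp
    rw [map_sum] at this
    exact_mod_cast this
  by_contra! hcon
  obtain ⟨i₀, j₀, h₀⟩ := hcon
  have := hmin (fun i j => g i j - (φ (g i j) : ℝ) * (g a b / (φ (g a b) : ℝ)))
    (fun h => h₀ (by have := congrFun (congrFun h i₀) j₀; simp at this; linarith))
    (fun i => by simp only [Finset.sum_sub_distrib, ← Finset.sum_mul, hr, hr']; simp)
    (fun j => by simp only [Finset.sum_sub_distrib, ← Finset.sum_mul, hc, hc']; simp)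
    (by
      rintro ⟨i, j⟩ h hz
      simp only [Set.mem_ofPred_eq] at h hz
      rw [hz] at h
      simp at h)
  have hm : ((a, b) : Fin m × Fin n) ∈ {p : Fin m × Fin n | g p.1 p.2 ≠ 0} := hab
  rw [← this] at hm
  apply hm
  simp only
  field_simp
  simp

lemma extreme_of {m n : ℕ} {u : Fin m → ℝ} {v : Fin n → ℝ} {y : Matrix (Fin m) (Fin n) ℝ}
    (hy : y ∈ TP m n u v)
    (h : ∀ z : Fin m → Fin n → ℝ, (∀ i, ∑ j, z i j = 0) → (∀ j, ∑ i, z i j = 0) →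
      (∀ i j, y i j = 0 → z i j = 0) → ∀ i j, z i j = 0) :
    y ∈ Set.extremePoints ℝ (TP m n u v) := by
  refine mem_extremePoints_iff_left.2 ⟨hy, ?_⟩
  rintro a ⟨ha0, ha1, ha2⟩ b ⟨hb0, hb1, hb2⟩ ⟨s, t, hs, ht, hst, rfl⟩
  obtain ⟨hy0, hy1, hy2⟩ := hy
  have := h (fun i j => a i j - (s • a + t • b) i j)
    (fun i => by rw [Finset.sum_sub_distrib, ha1, hy1, sub_self])
    (fun j => by rw [Finset.sum_sub_distrib, ha2, hy2, sub_self])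
    (fun i j hz => by
      simp only [hz]
      simp only [Matrix.add_apply, Matrix.smul_apply, smul_eq_mul] at hz
      have h1 := mul_nonneg hs.le (ha0 i j)
      have h2 := mul_nonneg ht.le (hb0 i j)
      have h3 : s * a i j = 0 := by linarith
      have := (mul_eq_zero.1 h3).resolve_left hs.ne'
      linarith)
  ext i j
  linarith [this i j]

lemma main_of_good {m n : ℕ} {ι : Type} [Fintype ι] (hG : Good (Fin m) (Fin n) ι) :
    ∃ (u : Fin m → ℝ) (v : Fin n → ℝ),
      (∀ i, 0 < u i) ∧ (∀ j, 0 < v j) ∧ (∑ i, u i = ∑ j, v j) ∧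
      ∃ O F : Matrix (Fin m) (Fin n) ℝ,
        O ∈ Set.extremePoints ℝ (TP m n u v) ∧
        F ∈ Set.extremePoints ℝ (TP m n u v) ∧
        ∀ (k : ℕ) (g : Fin k → Matrix (Fin m) (Fin n) ℝ) (α : Fin k → ℝ),
          (∀ i, IsCircuit m n (g i)) → (∀ i, 0 < α i) →
          F - O = ∑ i, α i • g i →
          Fintype.card ι ≤ k := by
  obtain ⟨O, F, h1, h2, h3, h4, h5, h6, h7, h8, x, hx, h9⟩ := hG
  refine ⟨fun i => ∑ j, O i j, fun j => ∑ i, O i j, h5, h6, Finset.sum_comm, O, F,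
    extreme_of ⟨h1, fun _ => rfl, fun _ => rfl⟩ h7, extreme_of ⟨h2, h3, h4⟩ h8, ?_⟩
  intro k g α hg _ hD
  choose c q hq using fun i => circuit_rational (hg i)
  have hsp : Set.range x ≤ Submodule.span ℚ (Set.range fun i => α i * c i) := by
    rintro _ ⟨t, rfl⟩
    obtain ⟨i, j, h⟩ := h9 t
    have h' : F i j - O i j = ∑ l, α l * g l i j := by
      have := congrFun (congrFun hD i) j
      rw [Matrix.sum_apply] at this
      exact this
    have : x t = ∑ l, (-(q l i j)) • (α l * c l) := by
      rw [h, ← neg_sub, h', ← Finset.sum_neg_distrib]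
      refine Finset.sum_congr rfl fun l _ => ?_
      rw [hq, Rat.smul_def]; push_cast; ring
    rw [this]
    exact Submodule.sum_mem _ fun l _ => Submodule.smul_mem _ _ (Submodule.subset_span ⟨l, rfl⟩)
  classical
  have hle := linearIndependent_le_span' x hx _ hsp
  have h10 : Fintype.card (Set.range fun i => α i * c i) ≤ k := by
    simpa using Fintype.card_range_le (fun i => α i * c i)
  rw [Cardinal.mk_fintype] at hle
  exact (by exact_mod_cast hle : Fintype.card ι ≤ _).trans h10

lemma exists_li (ι : Type) [Fintype ι] (lo hi : ι → ℝ) (h0 : ∀ i, 0 < lo i)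
    (h : ∀ i, lo i < hi i) :
    ∃ x : ι → ℝ, LinearIndependent ℚ x ∧ ∀ i, lo i < x i ∧ x i < hi i := by
  obtain ⟨w, hw⟩ : ∃ w : ι → ℝ, LinearIndependent ℚ w := by
    have ht : Transcendental ℚ (liouvilleNumber (2 : ℕ)) := fun h =>
      transcendental_liouvilleNumber le_rfl ((IsFractionRing.isAlgebraic_iff ℤ ℚ ℝ).2 h)
    refine ⟨_, ht.linearIndependent_sub_inv.comp
      (fun i : ι => ((Fintype.equivFin ι i : ℕ) : ℚ)) ?_⟩
    intro i j hij
    simpa [Fin.val_inj] using hij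
  have hq : ∀ i, ∃ q : ℚ, lo i < q * w i ∧ q * w i < hi i := by
    intro i
    rcases lt_or_gt_of_ne (hw.ne_zero i) with hn | hp
    · obtain ⟨q, hq1, hq2⟩ := exists_rat_btwn (div_lt_div_of_neg_of_lt hn (h i))
      exact ⟨q, (lt_div_iff_of_neg hn).1 hq2, (div_lt_iff_of_neg hn).1 hq1⟩
    · obtain ⟨q, hq1, hq2⟩ := exists_rat_btwn (div_lt_div_of_pos_right (h i) hp)
      exact ⟨q, (div_lt_iff₀ hp).1 hq1, (lt_div_iff₀ hp).1 hq2⟩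
  choose q hq1 hq2 using hq
  have hq0 : ∀ i, q i ≠ 0 := by
    intro i hi0
    have := hq1 i
    rw [hi0] at this
    have := h0 i
    simp at *
    linarith
  refine ⟨fun i => (q i : ℝ) * w i, ?_, fun i => ⟨hq1 i, hq2 i⟩⟩
  have := hw.units_smul (fun i => Units.mk0 (q i) (hq0 i))
  convert this using 1
  ext i
  simp [Units.smul_def, Rat.smul_def]

/-- 2 × (b+1), b ≥ 1 -/
lemma good_two (B : Type) [Fintype B] [Nonempty B] : Good (Fin 2) (B ⊕ Unit) B := by
  obtain ⟨x, hx, hb⟩ := exists_li B (fun _ => 1) (fun _ => 2) (by simp) (by norm_num)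
  have hpos : ∀ b, 0 < x b := fun b => by linarith [(hb b).1]
  have hS : 0 < ∑ b, x b := Finset.sum_pos (fun b _ => hpos b) Finset.univ_nonempty
  refine ⟨![Sum.elim (fun _ => 0) (fun _ => ∑ b, x b), Sum.elim x (fun _ => 0)],
    ![Sum.elim x (fun _ => 0), Sum.elim (fun _ => 0) (fun _ => ∑ b, x b)],
    ?_, ?_, ?_, ?_, ?_, ?_, ?_, ?_, x, hx, fun t => ⟨1, Sum.inl t, by simp⟩⟩
  · rintro i (j | j) <;> fin_cases i <;> simp [hS.le, (hpos _).le]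
  · rintro i (j | j) <;> fin_cases i <;> simp [hS.le, (hpos _).le]
  · intro i; fin_cases i <;> simp
  · rintro (j | j) <;> simp
  · intro i; fin_cases i <;> simp [hS]
  · rintro (j | j) <;> simp [hS, hpos]
  · intro z hr hc hz
    have e0 : ∀ j, z 0 (Sum.inl j) = 0 := fun j => hz 0 _ (by simp)
    have e1 : z 1 (Sum.inr ()) = 0 := hz 1 _ (by simp)
    have e2 : ∀ j, z 1 (Sum.inl j) = 0 := fun j => by
      have := hc (Sum.inl j); simp [e0] at this; exact this
    have e3 : z 0 (Sum.inr ()) = 0 := by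
      have := hc (Sum.inr ()); simp [e1] at this; exact this
    rintro i (j | j) <;> fin_cases i <;> simp [e0, e1, e2, e3]
  · intro z hr hc hz
    have e0 : ∀ j, z 1 (Sum.inl j) = 0 := fun j => hz 1 _ (by simp)
    have e1 : z 0 (Sum.inr ()) = 0 := hz 0 _ (by simp)
    have e2 : ∀ j, z 0 (Sum.inl j) = 0 := fun j => by
      have := hc (Sum.inl j); simp [e0] at this; exact this
    have e3 : z 1 (Sum.inr ()) = 0 := by
      have := hc (Sum.inr ()); simp [e1] at this; exact this
    rintro i (j | j) <;> fin_cases i <;> simp [e0, e1, e2, e3]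

lemma good_three : Good (Fin 3) (Fin 3) (Fin 4) := by
  obtain ⟨x, hx, hb⟩ := exists_li (Fin 4) ![1, 1, 1, 9] ![2, 2, 2, 10]
    (by intro i; fin_cases i <;> simp) (by intro i; fin_cases i <;> norm_num)
  obtain ⟨p, hp⟩ : ∃ p, p = x 0 := ⟨_, rfl⟩
  obtain ⟨q, hq⟩ : ∃ p, p = x 1 := ⟨_, rfl⟩
  obtain ⟨r, hr⟩ : ∃ p, p = x 2 := ⟨_, rfl⟩
  obtain ⟨s, hs⟩ : ∃ p, p = x 3 := ⟨_, rfl⟩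
  have bp := hb 0
  have bq := hb 1
  have br := hb 2
  have bs := hb 3
  simp [← hp, ← hq, ← hr, ← hs] at bp bq br bs
  refine ⟨![![r + s - p, p, 0], ![0, q, r], ![0, 0, s]],
    ![![0, 0, r + s], ![q + r, 0, 0], ![s - p - q, p + q, 0]],
    ?_, ?_, ?_, ?_, ?_, ?_, ?_, ?_, x, hx, ?_⟩
  · intro i j; fin_cases i <;> fin_cases j <;> simp <;> linarith
  · intro i j; fin_cases i <;> fin_cases j <;> simp <;> linarith
  · intro i; fin_cases i <;> simp [Fin.sum_univ_three] <;> ring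
  · intro i; fin_cases i <;> simp [Fin.sum_univ_three] <;> ring
  · intro i; fin_cases i <;> simp [Fin.sum_univ_three] <;> linarith
  · intro i; fin_cases i <;> simp [Fin.sum_univ_three] <;> linarith
  · intro z hr hc hz
    have z1 := hz 0 2 (by simp)
    have z2 := hz 1 0 (by simp)
    have z3 := hz 2 0 (by simp)
    have z4 := hz 2 1 (by simp)
    have r0 := hr 0
    have r1 := hr 1
    have r2 := hr 2
    have c0 := hc 0
    have c1 := hc 1
    have c2 := hc 2
    rw [Fin.sum_univ_three] at r0 r1 r2 c0 c1 c2
    intro i j; fin_cases i <;> fin_cases j <;> simp <;> linarith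
  · intro z hr hc hz
    have z1 := hz 0 0 (by simp)
    have z2 := hz 0 1 (by simp)
    have z3 := hz 1 1 (by simp)
    have z4 := hz 1 2 (by simp)
    have z5 := hz 2 2 (by simp)
    have r0 := hr 0
    have r1 := hr 1
    have r2 := hr 2
    have c0 := hc 0
    have c1 := hc 1
    have c2 := hc 2
    rw [Fin.sum_univ_three] at r0 r1 r2 c0 c1 c2
    intro i j; fin_cases i <;> fin_cases j <;> simp <;> linarith
  · intro t
    fin_cases t
    · exact ⟨0, 1, by simp [hp]⟩
    · exact ⟨1, 1, by simp [hq]⟩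
    · exact ⟨1, 2, by simp [hr]⟩
    · exact ⟨2, 2, by simp [hs]⟩

lemma good_big (A B : Type) [Fintype A] [Fintype B] :
    Good (Fin 3 ⊕ A) (Fin 4 ⊕ B) (Fin 6 ⊕ A ⊕ B) := by
  obtain ⟨x, hx, hb⟩ := exists_li (Fin 6 ⊕ A ⊕ B)
    (Sum.elim ![3, 1, 1, 1, 1, 3]
      (Sum.elim (fun _ => 1 / (4 * (Fintype.card A + 1))) (fun _ => 1 / (4 * (Fintype.card B + 1)))))
    (Sum.elim ![3 + 1/20, 1 + 1/20, 1 + 1/20, 1 + 1/20, 1 + 1/20, 3 + 1/20]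
      (Sum.elim (fun _ => 1 / (2 * (Fintype.card A + 1))) (fun _ => 1 / (2 * (Fintype.card B + 1)))))
    (by
      rintro (i | i | i)
      · fin_cases i <;> simp
      · simp only [Sum.elim_inr, Sum.elim_inl]; positivity
      · simp only [Sum.elim_inr]; positivity)
    (by
      rintro (i | i | i)
      · fin_cases i <;> norm_num
      · simp only [Sum.elim_inr, Sum.elim_inl]
        apply one_div_lt_one_div_of_lt (by positivity)
        have : (0 : ℝ) < Fintype.card A + 1 := by positivity
        linarith
      · simp only [Sum.elim_inr]
        apply one_div_lt_one_div_of_lt (by positivity)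
        have : (0 : ℝ) < Fintype.card B + 1 := by positivity
        linarith)
  obtain ⟨d, hd⟩ : ∃ d : A → ℝ, d = fun i => x (Sum.inr (Sum.inl i)) := ⟨_, rfl⟩
  obtain ⟨e, he⟩ : ∃ d : B → ℝ, d = fun i => x (Sum.inr (Sum.inr i)) := ⟨_, rfl⟩
  have hdpos : ∀ i, 0 < d i := by
    intro i
    have := (hb (Sum.inr (Sum.inl i))).1
    simp only [Sum.elim_inr, Sum.elim_inl] at this
    rw [hd]
    exact lt_trans (by positivity) this
  have hepos : ∀ i, 0 < e i := by
    intro i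
    have := (hb (Sum.inr (Sum.inr i))).1
    simp only [Sum.elim_inr] at this
    rw [he]
    exact lt_trans (by positivity) this
  have aux : ∀ c : ℕ, (c : ℝ) * (1 / (2 * (c + 1))) ≤ 1 / 2 := by
    intro c
    have : (0 : ℝ) < c + 1 := by positivity
    rw [mul_one_div, div_le_div_iff₀ (by positivity) (by norm_num)]
    linarith
  obtain ⟨D, hD⟩ : ∃ D, D = ∑ i, d i := ⟨_, rfl⟩
  obtain ⟨E, hE⟩ : ∃ E, E = ∑ i, e i := ⟨_, rfl⟩
  have hD0 : 0 ≤ D := hD ▸ Finset.sum_nonneg fun i _ => (hdpos i).le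
  have hE0 : 0 ≤ E := hE ▸ Finset.sum_nonneg fun i _ => (hepos i).le
  have hD1 : D ≤ 1 / 2 := by
    refine le_trans ?_ (aux (Fintype.card A))
    rw [hD, ← nsmul_eq_mul]
    refine Finset.sum_le_card_nsmul _ _ _ fun i _ => ?_
    have := (hb (Sum.inr (Sum.inl i))).2
    simp only [Sum.elim_inr, Sum.elim_inl] at this
    rw [hd]
    exact this.le
  have hE1 : E ≤ 1 / 2 := by
    refine le_trans ?_ (aux (Fintype.card B))
    rw [hE, ← nsmul_eq_mul]
    refine Finset.sum_le_card_nsmul _ _ _ fun i _ => ?_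
    have := (hb (Sum.inr (Sum.inr i))).2
    simp only [Sum.elim_inr] at this
    rw [he]
    exact this.le
  obtain ⟨a, ha⟩ : ∃ p, p = x (Sum.inl 0) := ⟨_, rfl⟩
  obtain ⟨b, hb'⟩ : ∃ p, p = x (Sum.inl 1) := ⟨_, rfl⟩
  obtain ⟨c, hc'⟩ : ∃ p, p = x (Sum.inl 2) := ⟨_, rfl⟩
  obtain ⟨p, hp⟩ : ∃ p, p = x (Sum.inl 3) := ⟨_, rfl⟩
  obtain ⟨q, hq⟩ : ∃ p, p = x (Sum.inl 4) := ⟨_, rfl⟩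
  obtain ⟨r, hr'⟩ : ∃ p, p = x (Sum.inl 5) := ⟨_, rfl⟩
  have b0 := hb (Sum.inl 0)
  have b1 := hb (Sum.inl 1)
  have b2 := hb (Sum.inl 2)
  have b3 := hb (Sum.inl 3)
  have b4 := hb (Sum.inl 4)
  have b5 := hb (Sum.inl 5)
  simp [← ha, ← hb', ← hc', ← hp, ← hq, ← hr'] at b0 b1 b2 b3 b4 b5
  norm_num at b0 b1 b2 b3 b4 b5
  let MO : Fin 3 → Fin 4 → ℝ := ![![a, b, 0, 0], ![0, c, p, 0], ![0, 0, q, r]]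
  let MF : Fin 3 → Fin 4 → ℝ := ![![0, 0, p + q, a + b + E - p - q],
    ![a + b + c - q - r, 0, 0, r - a - b - E + p + q], ![D + q + r - b - c, b + c - D, 0, 0]]
  let O : Fin 3 ⊕ A → Fin 4 ⊕ B → ℝ := Sum.elim
    (fun i => Sum.elim (MO i) (fun j => ![e j, 0, 0] i))
    (fun i => Sum.elim ![d i, 0, 0, 0] (fun _ => 0))
  let F : Fin 3 ⊕ A → Fin 4 ⊕ B → ℝ := Sum.elim
    (fun i => Sum.elim (MF i) (fun j => ![0, e j, 0] i))
    (fun i => Sum.elim ![0, d i, 0, 0] (fun _ => 0))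
  refine ⟨O, F, ?_, ?_, ?_, ?_, ?_, ?_, ?_, ?_, x, hx, ?_⟩
  · rintro (i | i) (j | j)
    · fin_cases i <;> fin_cases j <;> simp [O, MO] <;> linarith
    · fin_cases i <;> simp [O, (hepos _).le]
    · fin_cases j <;> simp [O, (hdpos _).le]
    · simp [O]
  · rintro (i | i) (j | j)
    · fin_cases i <;> fin_cases j <;> simp [F, MF] <;> linarith
    · fin_cases i <;> simp [F, (hepos _).le]
    · fin_cases j <;> simp [F, (hdpos _).le]
    · simp [F]
  · rintro (i | i)
    · fin_cases i <;> simp [O, F, MO, MF, Fin.sum_univ_four, ← hE] <;> ring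
    · simp [O, F, Fin.sum_univ_four]
  · rintro (j | j)
    · fin_cases j <;> simp [O, F, MO, MF, Fin.sum_univ_three, ← hD] <;> ring
    · simp [O, F, Fin.sum_univ_three]
  · rintro (i | i)
    · fin_cases i <;> simp [O, MO, Fin.sum_univ_four, ← hE] <;> linarith
    · simp [O, Fin.sum_univ_four, hdpos]
  · rintro (j | j)
    · fin_cases j <;> simp [O, MO, Fin.sum_univ_three, ← hD] <;> linarith
    · simp [O, Fin.sum_univ_three, hepos]
  · intro z hr hc hz
    have zAB : ∀ i j, z (Sum.inr i) (Sum.inr j) = 0 := fun i j => hz _ _ (by simp [O])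
    have zA1 : ∀ i, z (Sum.inr i) (Sum.inl 1) = 0 := fun i => hz _ _ (by simp [O])
    have zA2 : ∀ i, z (Sum.inr i) (Sum.inl 2) = 0 := fun i => hz _ _ (by simp [O])
    have zA3 : ∀ i, z (Sum.inr i) (Sum.inl 3) = 0 := fun i => hz _ _ (by simp [O])
    have zA0 : ∀ i, z (Sum.inr i) (Sum.inl 0) = 0 := fun i => by
      have := hr (Sum.inr i)
      simpa [Fin.sum_univ_four, zAB, zA1, zA2, zA3] using this
    have zB1 : ∀ j, z (Sum.inl 1) (Sum.inr j) = 0 := fun i => hz _ _ (by simp [O])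
    have zB2 : ∀ j, z (Sum.inl 2) (Sum.inr j) = 0 := fun i => hz _ _ (by simp [O])
    have zB0 : ∀ j, z (Sum.inl 0) (Sum.inr j) = 0 := fun j => by
      have := hc (Sum.inr j)
      simpa [Fin.sum_univ_three, zAB, zB1, zB2] using this
    have z1 := hz (Sum.inl 0) (Sum.inl 2) (by simp [O, MO])
    have z2 := hz (Sum.inl 0) (Sum.inl 3) (by simp [O, MO])
    have z3 := hz (Sum.inl 1) (Sum.inl 0) (by simp [O, MO])
    have z4 := hz (Sum.inl 1) (Sum.inl 3) (by simp [O, MO])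
    have z5 := hz (Sum.inl 2) (Sum.inl 0) (by simp [O, MO])
    have z6 := hz (Sum.inl 2) (Sum.inl 1) (by simp [O, MO])
    have r0 := hr (Sum.inl 0)
    have r1 := hr (Sum.inl 1)
    have r2 := hr (Sum.inl 2)
    have c0 := hc (Sum.inl 0)
    have c1 := hc (Sum.inl 1)
    have c2 := hc (Sum.inl 2)
    have c3 := hc (Sum.inl 3)
    simp only [Fintype.sum_sum_type, Fin.sum_univ_four, Fin.sum_univ_three, zA0, zA1, zA2, zA3,
      zB0, zB1, zB2, Finset.sum_const_zero] at r0 r1 r2 c0 c1 c2 c3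
    rintro (i | i) (j | j)
    · fin_cases i <;> fin_cases j <;> simp <;> linarith
    · fin_cases i <;> simp [zB0, zB1, zB2]
    · fin_cases j <;> simp [zA0, zA1, zA2, zA3]
    · exact zAB i j
  · intro z hr hc hz
    have zAB : ∀ i j, z (Sum.inr i) (Sum.inr j) = 0 := fun i j => hz _ _ (by simp [F])
    have zA0 : ∀ i, z (Sum.inr i) (Sum.inl 0) = 0 := fun i => hz _ _ (by simp [F])
    have zA2 : ∀ i, z (Sum.inr i) (Sum.inl 2) = 0 := fun i => hz _ _ (by simp [F])
    have zA3 : ∀ i, z (Sum.inr i) (Sum.inl 3) = 0 := fun i => hz _ _ (by simp [F])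
    have zA1 : ∀ i, z (Sum.inr i) (Sum.inl 1) = 0 := fun i => by
      have := hr (Sum.inr i)
      simpa [Fin.sum_univ_four, zAB, zA0, zA2, zA3] using this
    have zB0 : ∀ j, z (Sum.inl 0) (Sum.inr j) = 0 := fun i => hz _ _ (by simp [F])
    have zB2 : ∀ j, z (Sum.inl 2) (Sum.inr j) = 0 := fun i => hz _ _ (by simp [F])
    have zB1 : ∀ j, z (Sum.inl 1) (Sum.inr j) = 0 := fun j => by
      have := hc (Sum.inr j)
      simpa [Fin.sum_univ_three, zAB, zB0, zB2] using this
    have z1 := hz (Sum.inl 0) (Sum.inl 0) (by simp [F, MF])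
    have z2 := hz (Sum.inl 0) (Sum.inl 1) (by simp [F, MF])
    have z3 := hz (Sum.inl 1) (Sum.inl 1) (by simp [F, MF])
    have z4 := hz (Sum.inl 1) (Sum.inl 2) (by simp [F, MF])
    have z5 := hz (Sum.inl 2) (Sum.inl 2) (by simp [F, MF])
    have z6 := hz (Sum.inl 2) (Sum.inl 3) (by simp [F, MF])
    have r0 := hr (Sum.inl 0)
    have r1 := hr (Sum.inl 1)
    have r2 := hr (Sum.inl 2)
    have c0 := hc (Sum.inl 0)
    have c1 := hc (Sum.inl 1)
    have c2 := hc (Sum.inl 2)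
    have c3 := hc (Sum.inl 3)
    simp only [Fintype.sum_sum_type, Fin.sum_univ_four, Fin.sum_univ_three, zA0, zA1, zA2, zA3,
      zB0, zB1, zB2, Finset.sum_const_zero] at r0 r1 r2 c0 c1 c2 c3
    rintro (i | i) (j | j)
    · fin_cases i <;> fin_cases j <;> simp <;> linarith
    · fin_cases i <;> simp [zB0, zB1, zB2]
    · fin_cases j <;> simp [zA0, zA1, zA2, zA3]
    · exact zAB i j
  · rintro (t | t | t)
    · fin_cases t
      · exact ⟨Sum.inl 0, Sum.inl 0, by simp [O, F, MO, MF, ha]⟩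
      · exact ⟨Sum.inl 0, Sum.inl 1, by simp [O, F, MO, MF, hb']⟩
      · exact ⟨Sum.inl 1, Sum.inl 1, by simp [O, F, MO, MF, hc']⟩
      · exact ⟨Sum.inl 1, Sum.inl 2, by simp [O, F, MO, MF, hp]⟩
      · exact ⟨Sum.inl 2, Sum.inl 2, by simp [O, F, MO, MF, hq]⟩
      · exact ⟨Sum.inl 2, Sum.inl 3, by simp [O, F, MO, MF, hr']⟩
    · exact ⟨Sum.inr t, Sum.inl 0, by simp [O, F, hd]⟩
    · exact ⟨Sum.inl 0, Sum.inr t, by simp [O, F, he]⟩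

lemma Good.reindex_both {ρ κ ι ρ' κ' : Type} [Fintype ρ] [Fintype κ] [Fintype ρ'] [Fintype κ']
    (e : ρ' ≃ ρ) (f : κ' ≃ κ) (h : Good ρ κ ι) : Good ρ' κ' ι :=
  ((h.reindex e).symm.reindex f).symm

lemma good_two_fin (n : ℕ) (hn : 2 ≤ n) : Good (Fin 2) (Fin n) (Fin (n - 1)) := by
  haveI : Nonempty (Fin (n - 1)) := ⟨⟨0, by omega⟩⟩
  refine (good_two (Fin (n - 1))).reindex_both (Equiv.refl _) (Fintype.equivOfCardEq ?_)
  simp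
  omega

lemma good_big_fin (m n : ℕ) (hm : 3 ≤ m) (hn : 4 ≤ n) :
    Good (Fin m) (Fin n) (Fin 6 ⊕ Fin (m - 3) ⊕ Fin (n - 4)) := by
  refine (good_big (Fin (m - 3)) (Fin (n - 4))).reindex_both
    (Fintype.equivOfCardEq ?_) (Fintype.equivOfCardEq ?_)
  · simp; omega
  · simp; omega

lemma exists_good (m n : ℕ) (hm : 2 ≤ m) (hn : 2 ≤ n) :
    ∃ (ι : Type) (_ : Fintype ι), Good (Fin m) (Fin n) ι ∧
      min ((m - 1) * (n - 1)) (m + n - 1) ≤ Fintype.card ι := by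
  rcases hm.eq_or_lt with rfl | hm
  · exact ⟨_, inferInstance, good_two_fin n hn, by simp⟩
  rcases hn.eq_or_lt with rfl | hn
  · exact ⟨_, inferInstance, (good_two_fin m (by omega)).symm, by simp⟩
  by_cases h4 : 4 ≤ n
  · exact ⟨_, inferInstance, good_big_fin m n hm h4, by
      simp only [Fintype.card_sum, Fintype.card_fin]; omega⟩
  by_cases h4' : 4 ≤ m
  · exact ⟨_, inferInstance, (good_big_fin n m hn h4').symm, by
      simp only [Fintype.card_sum, Fintype.card_fin]; omega⟩
  obtain rfl : m = 3 := by omega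
  obtain rfl : n = 3 := by omega
  exact ⟨_, inferInstance, good_three, by simp⟩

/-- for all m, n ≥ 2 there are positive margins u, v and vertices O, F of the
m×n transportation polytope such that every decomposition F − O = ∑ αᵢ gⁱ into positive
multiples of circuits uses at least min{(m−1)(n−1), m+n−1} circuits; equivalently every
(not necessarily feasible) circuit walk from O to F has length at least that bound. -/
theorem stmt_1 (m n : ℕ) (hm : 2 ≤ m) (hn : 2 ≤ n) :
    ∃ (u : Fin m → ℝ) (v : Fin n → ℝ),
      (∀ i, 0 < u i) ∧ (∀ j, 0 < v j) ∧ (∑ i, u i = ∑ j, v j) ∧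
      ∃ O F : Matrix (Fin m) (Fin n) ℝ,
        O ∈ Set.extremePoints ℝ (TP m n u v) ∧
        F ∈ Set.extremePoints ℝ (TP m n u v) ∧
        ∀ (k : ℕ) (g : Fin k → Matrix (Fin m) (Fin n) ℝ) (α : Fin k → ℝ),
          (∀ i, IsCircuit m n (g i)) → (∀ i, 0 < α i) →
          F - O = ∑ i, α i • g i →
          min ((m - 1) * (n - 1)) (m + n - 1) ≤ k := by
  obtain ⟨ι, hι, hG, hle⟩ := exists_good m n hm hn
  obtain ⟨u, v, h1, h2, h3, O, F, h4, h5, h6⟩ := main_of_good hG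
  exact ⟨u, v, h1, h2, h3, O, F, h4, h5, fun k g α hg hα hD => hle.trans (h6 k g α hg hα hD)⟩
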